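/- arXiv:2002.01628 — 4 statements merged into one kernel-verified Lean document; each statement's English description precedes it below -/
import Mathlib

section
/- Let $A \in \mathbb{R}^{n\times d}$, let $r \geq 1$ be an integer, and let $p = (p_1,\dots,p_d)$ be a probability vector with $p_k > 0$ for all $k$. Draw indices $i_1,\dots,i_r$ i.i.d. from $p$ and form $C \in \mathbb{R}^{n\times r}$ whose $t$-th column is $\frac{1}{\sqrt{r\,p_{i_t}}} A_{:,i_t}$. Then for every pair of row indices $(i,j)$, the variance of the estimator satisfies $\operatorname{Var}\big[(CC^{\top})_{ij}\big] = \frac{1}{r}\Big(\sum_{k=1}^{d} \frac{A_{ik}^2 A_{jk}^2}{p_k} - (AA^{\top})_{ij}^2\Big)$; in particular the variance of each entry depends on the choice of sampling probabilities. -/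
open Matrix

/-- The sampled-and-rescaled matrix `C ∈ ℝ^{n×r}` built from a draw `ω : Fin r → Fin d`
of column indices: the `t`-th column of `C` is the `ω t`-th column of `A`, rescaled by
`1 / √(r * p (ω t))`. -/
noncomputable def sampledMatrix {n d : ℕ} (r : ℕ) (A : Matrix (Fin n) (Fin d) ℝ)
    (p : Fin d → ℝ) (ω : Fin r → Fin d) : Matrix (Fin n) (Fin r) ℝ :=
  fun a t => A a (ω t) / Real.sqrt (r * p (ω t))

section ProductWeights

variable {ι κ : Type*} [Fintype ι] [DecidableEq ι] [Fintype κ]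

theorem sum_prod_weight_mul_prod (p : κ → ℝ) (f : ι → κ → ℝ) :
    ∑ ω : ι → κ, (∏ t, p (ω t)) * ∏ t, f t (ω t) = ∏ t, ∑ k, p k * f t k := by
  classical
  rw [Finset.prod_univ_sum, Fintype.piFinset_univ]
  simp only [Finset.prod_mul_distrib]

theorem sum_prod_weight_mul_apply {p : κ → ℝ} (hps : ∑ k, p k = 1) (h : κ → ℝ) (t : ι) :
    ∑ ω : ι → κ, (∏ u, p (ω u)) * h (ω t) = ∑ k, p k * h k := by
  have key := sum_prod_weight_mul_prod p (fun u k => if u = t then h k else 1)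
  rw [Finset.prod_eq_single t (fun u _ hu => by simp [hu, hps]) (by simp)] at key
  simpa using key

theorem sum_prod_weight_mul_apply_mul_apply {p : κ → ℝ} (h : κ → ℝ)
    (hh : ∑ k, p k * h k = 0) {s t : ι} (hst : s ≠ t) :
    ∑ ω : ι → κ, (∏ u, p (ω u)) * (h (ω s) * h (ω t)) = 0 := by
  have key := sum_prod_weight_mul_prod p
    (fun u k => (if u = s then h k else 1) * (if u = t then h k else 1))
  rw [Finset.prod_eq_zero (Finset.mem_univ s) (by simpa [hst] using hh)] at key
  simp only [Finset.prod_mul_distrib] at key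
  simpa [-mul_ite, -ite_mul] using key

theorem sum_prod_weight_mul_sum {p : κ → ℝ} (hps : ∑ k, p k = 1) (h : κ → ℝ) :
    ∑ ω : ι → κ, (∏ u, p (ω u)) * ∑ t, h (ω t) = Fintype.card ι * ∑ k, p k * h k := by
  simp_rw [Finset.mul_sum (s := (Finset.univ : Finset ι))]
  rw [Finset.sum_comm]
  simp [sum_prod_weight_mul_apply hps h]

theorem sum_prod_weight_mul_sum_sq {p : κ → ℝ} (hps : ∑ k, p k = 1) (h : κ → ℝ)
    (hh : ∑ k, p k * h k = 0) :
    ∑ ω : ι → κ, (∏ u, p (ω u)) * (∑ t, h (ω t)) ^ 2 =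
      Fintype.card ι * ∑ k, p k * h k ^ 2 := by
  simp_rw [sq (∑ t, h _), Finset.sum_mul_sum, Finset.mul_sum (s := (Finset.univ : Finset ι))]
  rw [Finset.sum_comm]
  have inner (s : ι) :
      ∑ ω : ι → κ, ∑ t, (∏ u, p (ω u)) * (h (ω s) * h (ω t)) = ∑ k, p k * h k ^ 2 := by
    rw [Finset.sum_comm, Finset.sum_eq_single s
      (fun t _ hts => sum_prod_weight_mul_apply_mul_apply h hh hts.symm) (by simp)]
    simp only [← sq]
    exact sum_prod_weight_mul_apply hps (fun k => h k ^ 2) s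
  simp [inner]

/-- The variance of a sum of independent copies of `X` is the number of copies times the
variance of `X`. -/
theorem variance_sum_prod_weight {p : κ → ℝ} (hps : ∑ k, p k = 1) (X : κ → ℝ) :
    ∑ ω : ι → κ, (∏ u, p (ω u)) *
        (∑ t, X (ω t) - ∑ ω' : ι → κ, (∏ u, p (ω' u)) * ∑ t, X (ω' t)) ^ 2 =
      Fintype.card ι * (∑ k, p k * X k ^ 2 - (∑ k, p k * X k) ^ 2) := by
  rw [sum_prod_weight_mul_sum hps]
  set m := ∑ k, p k * X k with hm
  have centered : ∑ k, p k * (X k - m) = 0 := by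
    simp only [mul_sub, Finset.sum_sub_distrib, ← Finset.sum_mul, hps, ← hm]
    ring
  have second_moment : ∑ k, p k * (X k - m) ^ 2 = ∑ k, p k * X k ^ 2 - m ^ 2 := by
    have expand (k : κ) :
        p k * (X k - m) ^ 2 = p k * X k ^ 2 - 2 * m * (p k * X k) + p k * m ^ 2 := by ring
    simp only [expand, Finset.sum_add_distrib, Finset.sum_sub_distrib, ← Finset.sum_mul,
      ← Finset.mul_sum, hps, ← hm]
    ring
  rw [← second_moment, ← sum_prod_weight_mul_sum_sq hps _ centered]
  simp

end ProductWeights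

theorem sampledMatrix_mul_transpose_apply {n d : ℕ} (r : ℕ) (A : Matrix (Fin n) (Fin d) ℝ)
    {p : Fin d → ℝ} (hp : ∀ k, 0 < p k) (ω : Fin r → Fin d) (i j : Fin n) :
    (sampledMatrix r A p ω * (sampledMatrix r A p ω)ᵀ) i j =
      ∑ t, A i (ω t) * A j (ω t) / (r * p (ω t)) := by
  simp only [Matrix.mul_apply, Matrix.transpose_apply, sampledMatrix]
  refine Finset.sum_congr rfl fun t _ => ?_
  rw [div_mul_div_comm, Real.mul_self_sqrt (mul_nonneg r.cast_nonneg (hp _).le)]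

/-- The variance of each entry `(C Cᵀ)_{ij}` of the sampled-and-rescaled product, over the
`r` i.i.d. draws of column indices from the distribution `p` (the weight of the draw `ω`
is `∏ t, p (ω t)`), equals
`(1/r) * (∑ₖ A_{ik}² A_{jk}² / pₖ − (A Aᵀ)_{ij}²)`;
in particular it depends on the choice of sampling probabilities. -/
theorem sampled_product_variance {n d : ℕ} (r : ℕ) (hr : 0 < r)
    (A : Matrix (Fin n) (Fin d) ℝ) (p : Fin d → ℝ)
    (hp : ∀ k, 0 < p k) (hps : ∑ k, p k = 1) (i j : Fin n) :
    ∑ ω : Fin r → Fin d, (∏ t, p (ω t)) *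
        (((sampledMatrix r A p ω) * (sampledMatrix r A p ω)ᵀ) i j
          - ∑ ω' : Fin r → Fin d, (∏ t, p (ω' t)) *
              ((sampledMatrix r A p ω') * (sampledMatrix r A p ω')ᵀ) i j) ^ 2
      = (1 / r) * ((∑ k, (A i k) ^ 2 * (A j k) ^ 2 / p k) - ((A * Aᵀ) i j) ^ 2) := by
  have hr' : (r : ℝ) ≠ 0 := by positivity
  simp only [sampledMatrix_mul_transpose_apply r A hp]
  rw [variance_sum_prod_weight hps (fun k => A i k * A j k / (r * p k)), Fintype.card_fin]
  have mean : ∑ k, p k * (A i k * A j k / (r * p k)) = (A * Aᵀ) i j / r := by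
    rw [Matrix.mul_apply, Finset.sum_div]
    refine Finset.sum_congr rfl fun k _ => ?_
    have := (hp k).ne'
    rw [Matrix.transpose_apply]
    field_simp
  have second_moment : ∑ k, p k * (A i k * A j k / (r * p k)) ^ 2 =
      (∑ k, A i k ^ 2 * A j k ^ 2 / p k) / r ^ 2 := by
    rw [Finset.sum_div]
    refine Finset.sum_congr rfl fun k _ => ?_
    have := (hp k).ne'
    field_simp
  rw [mean, second_moment]
  field_simp
end

section
/- Let $A \in \mathbb{R}^{n\times d}$, let $r \geq 1$ be an integer, and let $p = (p_1,\dots,p_d)$ be a probability vector with $p_k > 0$ for all $k$. Draw indices $i_1,\dots,i_r$ i.i.d. from $p$ and form $C \in \mathbb{R}^{n\times r}$ whose $t$-th column is $\frac{1}{\sqrt{r\,p_{i_t}}} A_{:,i_t}$. Then the expected squared Frobenius-norm approximation error satisfies $\mathbb{E}\big[\|CC^{\top} - AA^{\top}\|_F^2\big] = \frac{1}{r}\Big(\sum_{k=1}^{d} \frac{\|A_{:,k}\|_2^4}{p_k} - \|AA^{\top}\|_F^2\Big)$, where $\|A_{:,k}\|_2$ denotes the Euclidean norm of the $k$-th column of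 $A$. -/
open Matrix

/-- The squared Frobenius norm `‖M‖_F² = ∑ᵢⱼ M_{ij}²` of a real matrix. -/
def frobSq {m n : ℕ} (M : Matrix (Fin m) (Fin n) ℝ) : ℝ :=
  ∑ i, ∑ j, (M i j) ^ 2

/-- The weights of all `r`-fold i.i.d. draws from a probability vector sum to one. -/
lemma sum_prod_weights_eq_one {ι : Type*} [Fintype ι] (p : ι → ℝ) (hps : ∑ k, p k = 1)
    (r : ℕ) : ∑ ω : Fin r → ι, ∏ t, p (ω t) = 1 := by
  classical
  rw [← Fintype.piFinset_univ, Finset.sum_prod_piFinset (Finset.univ : Finset ι) fun _ k => p k]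
  simp [hps]

/-- The sum of `r` i.i.d. centered variables has variance `r` times that of one of them. -/
lemma sum_prod_weights_mul_sq_sum {ι : Type*} [Fintype ι] (p f : ι → ℝ) (hps : ∑ k, p k = 1)
    (hf : ∑ k, p k * f k = 0) (r : ℕ) :
    ∑ ω : Fin r → ι, (∏ t, p (ω t)) * (∑ t, f (ω t)) ^ 2 = r * ∑ k, p k * f k ^ 2 := by
  induction r with
  | zero => simp
  | succ r ih =>
    rw [← (Fin.consEquiv fun _ => ι).sum_comp, Fintype.sum_prod_type]
    simp only [Fin.consEquiv_apply, Fin.prod_univ_succ, Fin.sum_univ_succ, Fin.cons_zero,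
      Fin.cons_succ]
    calc ∑ k, ∑ ω : Fin r → ι, p k * (∏ t, p (ω t)) * (f k + ∑ t, f (ω t)) ^ 2
        = ∑ k, (p k * f k ^ 2 * ∑ ω : Fin r → ι, ∏ t, p (ω t)
            + p k * f k * (2 * ∑ ω : Fin r → ι, (∏ t, p (ω t)) * ∑ t, f (ω t))
            + p k * ∑ ω : Fin r → ι, (∏ t, p (ω t)) * (∑ t, f (ω t)) ^ 2) := by
          refine Finset.sum_congr rfl fun k _ => ?_
          simp only [Finset.mul_sum _ (fun ω : Fin r → ι => _), ← Finset.sum_add_distrib]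
          exact Finset.sum_congr rfl fun ω _ => by ring
      _ = (r + 1 : ℕ) * ∑ k, p k * f k ^ 2 := by
          rw [Finset.sum_add_distrib, Finset.sum_add_distrib, ← Finset.sum_mul, ← Finset.sum_mul,
            ← Finset.sum_mul, sum_prod_weights_eq_one p hps, hf, hps, ih]
          push_cast
          ring

/-- The entries of the approximation error are averages of i.i.d. centered variables. -/
lemma sampledMatrix_mul_transpose_sub_apply {n d r : ℕ} (hr : 0 < r)
    (A : Matrix (Fin n) (Fin d) ℝ) (p : Fin d → ℝ) (hp : ∀ k, 0 < p k) (ω : Fin r → Fin d)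
    (a b : Fin n) :
    (sampledMatrix r A p ω * (sampledMatrix r A p ω)ᵀ - A * Aᵀ) a b
      = (1 / r) * ∑ t, (A a (ω t) * A b (ω t) / p (ω t) - (A * Aᵀ) a b) := by
  have hr' : (r : ℝ) ≠ 0 := by positivity
  rw [Finset.sum_sub_distrib, Finset.sum_const, Finset.card_univ, Fintype.card_fin, nsmul_eq_mul,
    mul_sub, one_div, inv_mul_cancel_left₀ hr', Finset.mul_sum, Matrix.sub_apply, mul_apply]
  congr 1
  refine Finset.sum_congr rfl fun t _ => ?_
  have hpt := (hp (ω t)).ne'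
  rw [transpose_apply, sampledMatrix, sampledMatrix, div_mul_div_comm,
    Real.mul_self_sqrt (mul_nonneg r.cast_nonneg (hp _).le)]
  field_simp

/-- The variance of `x / p` under a probability vector `p`. -/
lemma sum_weights_mul_sq_div_sub {ι : Type*} [Fintype ι] (p x : ι → ℝ) (hp : ∀ k, 0 < p k)
    (hps : ∑ k, p k = 1) :
    ∑ k, p k * (x k / p k - ∑ l, x l) ^ 2 = ∑ k, x k ^ 2 / p k - (∑ k, x k) ^ 2 := by
  set m := ∑ l, x l with hm
  calc ∑ k, p k * (x k / p k - m) ^ 2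
      = ∑ k, (x k ^ 2 / p k - x k * (2 * m) + p k * m ^ 2) := by
        refine Finset.sum_congr rfl fun k _ => ?_
        have := (hp k).ne'
        field_simp
        ring
    _ = ∑ k, x k ^ 2 / p k - m ^ 2 := by
        rw [Finset.sum_add_distrib, Finset.sum_sub_distrib, ← Finset.sum_mul, ← Finset.sum_mul,
          hps, ← hm]
        ring

/-- The expected squared Frobenius-norm error of the sampled-and-rescaled product, over
the `r` i.i.d. draws of column indices from the distribution `p` (the weight of the
draw `ω` is `∏ t, p (ω t)`), equals
`(1/r) * (∑ₖ ‖A_{:,k}‖₂⁴ / pₖ − ‖A Aᵀ‖_F²)`. -/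
theorem sampled_product_expected_frobenius_error {n d : ℕ} (r : ℕ) (hr : 0 < r)
    (A : Matrix (Fin n) (Fin d) ℝ) (p : Fin d → ℝ)
    (hp : ∀ k, 0 < p k) (hps : ∑ k, p k = 1) :
    ∑ ω : Fin r → Fin d, (∏ t, p (ω t)) *
        frobSq ((sampledMatrix r A p ω) * (sampledMatrix r A p ω)ᵀ - A * Aᵀ)
      = (1 / r) * ((∑ k, (∑ i, (A i k) ^ 2) ^ 2 / p k) - frobSq (A * Aᵀ)) := by
  have hr' : (r : ℝ) ≠ 0 := by positivity
  have entry (a b : Fin n) : ∑ ω : Fin r → Fin d, (∏ t, p (ω t)) *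
      ((sampledMatrix r A p ω * (sampledMatrix r A p ω)ᵀ - A * Aᵀ) a b) ^ 2
        = (1 / r) * (∑ k, (A a k * A b k) ^ 2 / p k - ((A * Aᵀ) a b) ^ 2) := by
    have hm : (A * Aᵀ) a b = ∑ k, A a k * A b k := rfl
    have hcentered : ∑ k, p k * (A a k * A b k / p k - (A * Aᵀ) a b) = 0 := by
      simp only [mul_sub, mul_div_cancel₀ _ (hp _).ne', Finset.sum_sub_distrib, ← Finset.sum_mul,
        hps, hm, one_mul, sub_self]
    simp only [sampledMatrix_mul_transpose_sub_apply hr A p hp, mul_pow (1 / (r : ℝ)),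
      mul_left_comm _ ((1 / (r : ℝ)) ^ 2)]
    rw [← Finset.mul_sum, sum_prod_weights_mul_sq_sum p
      (fun k => A a k * A b k / p k - (A * Aᵀ) a b) hps hcentered, hm,
      sum_weights_mul_sq_div_sub p (fun k => A a k * A b k) hp hps]
    field_simp
  have hcols : ∑ k, (∑ i, A i k ^ 2) ^ 2 / p k
      = ∑ a, ∑ b, ∑ k, (A a k * A b k) ^ 2 / p k := by
    simp only [sq (∑ i, A i _ ^ 2), Finset.sum_mul_sum, Finset.sum_div, ← mul_pow]
    rw [Finset.sum_comm]
    exact Finset.sum_congr rfl fun a _ => Finset.sum_comm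
  rw [hcols]
  simp only [frobSq, Finset.mul_sum (Finset.univ : Finset (Fin n)), ← Finset.sum_sub_distrib]
  rw [Finset.sum_comm]
  refine Finset.sum_congr rfl fun a _ => ?_
  rw [Finset.sum_comm]
  exact Finset.sum_congr rfl fun b _ => entry a b
end

section
/- (Proposition 1) Let $X \in \mathbb{R}^{n\times d}$, let $D \in \mathbb{R}^{d\times d}$ be diagonal with $D_{ii} \in \{1,-1\}$, let $H \in \mathbb{R}^{d\times d}$ satisfy $HH^{\top} = I$, and set $X_r = XDH$, so that $X_r X_r^{\top} = XX^{\top}$. Fix an integer $r \geq 1$. For a probability vector $p = (p_1,\dots,p_d)$ with $p_j > 0$, draw indices $i_1,\dots,i_r$ i.i.d. from $p$ and let $\widetilde{X} \in \mathbb{R}^{n\times r}$ have $t$-th column $\frac{1}{\sqrt{r\,p_{i_t}}} (X_r)_{:,i_t}$. Then the choice $p_j = \frac{\|X_{r(:,j)}\|_2^2}{\sum_{k=1}^{d}\|X_{r(:,k)}\|_2^2}$ minimizes the expected squared Frobenius approximation error $\mathbb{E}\big[\|\widetilde{X}\widetilde{X}^{\top} - XX^{\top}\|_F^2\big]$ over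 all probability vectors $p$; i.e. for every probability vector $q$ with positive entries, the expected squared error under $q$ is at least the expected squared error under this $p$, whose value is $\frac{1}{r}\Big(\big(\sum_{k=1}^d \|X_{r(:,k)}\|_2^2\big)^2 - \|XX^{\top}\|_F^2\Big)$. -/
open Matrix

/-- The second moment of a shifted sum of `r` i.i.d. centred terms. -/
theorem sum_prod_mul_sq_add_sum {ι : Type*} [Fintype ι] (q g : ι → ℝ)
    (hq : ∑ j, q j = 1) (hg : ∑ j, q j * g j = 0) (r : ℕ) (c : ℝ) :
    ∑ ω : Fin r → ι, (∏ t, q (ω t)) * (c + ∑ t, g (ω t)) ^ 2 =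
      c ^ 2 + r * ∑ j, q j * g j ^ 2 := by
  induction r generalizing c with
  | zero => simp
  | succ r ih =>
    rw [← (Fin.consEquiv fun _ : Fin (r + 1) => ι).sum_comp, Fintype.sum_prod_type]
    have step (j : ι) : ∑ ω : Fin r → ι,
        (∏ t, q ((Fin.consEquiv fun _ : Fin (r + 1) => ι) (j, ω) t)) *
          (c + ∑ t, g ((Fin.consEquiv fun _ : Fin (r + 1) => ι) (j, ω) t)) ^ 2 =
        c ^ 2 * q j + 2 * c * (q j * g j) + q j * g j ^ 2 +
          (r * ∑ k, q k * g k ^ 2) * q j := by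
      have h : c ^ 2 * q j + 2 * c * (q j * g j) + q j * g j ^ 2 +
          (r * ∑ k, q k * g k ^ 2) * q j =
          q j * ((c + g j) ^ 2 + r * ∑ k, q k * g k ^ 2) := by ring
      rw [h, ← ih, Finset.mul_sum]
      refine Finset.sum_congr rfl fun ω _ => ?_
      simp only [Fin.consEquiv_apply, Fin.prod_univ_succ, Fin.sum_univ_succ, Fin.cons_zero,
        Fin.cons_succ]
      ring
    simp only [step, Finset.sum_add_distrib, ← Finset.mul_sum, hq, hg]
    push_cast
    ring

/-- The variance of the mean of `r` i.i.d. samples. -/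
theorem sum_prod_mul_sq_mean_sub {ι : Type*} [Fintype ι] (q f : ι → ℝ)
    (hq : ∑ j, q j = 1) {r : ℕ} (hr : 0 < r) :
    ∑ ω : Fin r → ι, (∏ t, q (ω t)) * (∑ t, f (ω t) / r - ∑ j, q j * f j) ^ 2 =
      (1 / r) * (∑ j, q j * f j ^ 2 - (∑ j, q j * f j) ^ 2) := by
  have hr' : (r : ℝ) ≠ 0 := by positivity
  set m := ∑ j, q j * f j with hm
  have hg : ∑ j, q j * ((f j - m) / r) = 0 := by
    simp only [mul_div_assoc', mul_sub, ← Finset.sum_div, Finset.sum_sub_distrib,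
      ← Finset.sum_mul, hq, ← hm]
    simp
  have hsq : ∑ j, q j * ((f j - m) / r) ^ 2 = (∑ j, q j * f j ^ 2 - m ^ 2) / r ^ 2 := by
    have h (j : ι) : q j * ((f j - m) / r) ^ 2 =
        (q j * f j ^ 2 - 2 * m * (q j * f j) + m ^ 2 * q j) / r ^ 2 := by ring
    simp only [h, ← Finset.sum_div, Finset.sum_add_distrib, Finset.sum_sub_distrib,
      ← Finset.mul_sum, hq, ← hm]
    ring
  have key := sum_prod_mul_sq_add_sum q (fun j => (f j - m) / r) hq hg r 0
  rw [hsq] at key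
  convert key using 1
  · refine Finset.sum_congr rfl fun ω _ => ?_
    congr 2
    simp only [sub_div, Finset.sum_sub_distrib, Finset.sum_const, Finset.card_univ,
      Fintype.card_fin, nsmul_eq_mul]
    field_simp
    ring
  · field_simp
    ring

/-- The expected squared Frobenius error of column sampling, for any probability vector whose
support contains every nonzero column. -/
theorem sum_prod_mul_frobSq_sampledMatrix {n d : ℕ} {r : ℕ} (hr : 0 < r)
    (A : Matrix (Fin n) (Fin d) ℝ) (q : Fin d → ℝ) (hq₀ : ∀ j, 0 ≤ q j)
    (hq : ∑ j, q j = 1) (hA : ∀ j, q j = 0 → ∀ a, A a j = 0) :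
    ∑ ω : Fin r → Fin d, (∏ t, q (ω t)) *
        frobSq (sampledMatrix r A q ω * (sampledMatrix r A q ω)ᵀ - A * Aᵀ) =
      (1 / r) * (∑ j, (∑ a, A a j ^ 2) ^ 2 / q j - frobSq (A * Aᵀ)) := by
  have hmean (a b : Fin n) : (A * Aᵀ) a b = ∑ j, q j * (A a j * A b j / q j) := by
    rw [Matrix.mul_apply]
    refine Finset.sum_congr rfl fun j _ => ?_
    rw [Matrix.transpose_apply]
    by_cases h : q j = 0
    · simp [h, hA j h]
    · field_simp
  have hsample (ω : Fin r → Fin d) (a b : Fin n) :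
      (sampledMatrix r A q ω * (sampledMatrix r A q ω)ᵀ) a b =
        ∑ t, (A a (ω t) * A b (ω t) / q (ω t)) / r := by
    rw [Matrix.mul_apply]
    refine Finset.sum_congr rfl fun t _ => ?_
    rw [Matrix.transpose_apply, sampledMatrix, sampledMatrix, div_mul_div_comm,
      Real.mul_self_sqrt (mul_nonneg r.cast_nonneg (hq₀ _)), div_div, mul_comm (r : ℝ)]
  have hsecond : ∑ j, (∑ a, A a j ^ 2) ^ 2 / q j =
      ∑ a, ∑ b, ∑ j, q j * (A a j * A b j / q j) ^ 2 := by
    have h (j : Fin d) : (∑ a, A a j ^ 2) ^ 2 / q j =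
        ∑ a, ∑ b, q j * (A a j * A b j / q j) ^ 2 := by
      rw [sq (∑ a, A a j ^ 2), Finset.sum_mul_sum]
      simp only [Finset.sum_div]
      refine Finset.sum_congr rfl fun a _ => Finset.sum_congr rfl fun b _ => ?_
      by_cases h : q j = 0
      · simp [h]
      · field_simp
    simp only [h]
    rw [Finset.sum_comm]
    exact Finset.sum_congr rfl fun a _ => Finset.sum_comm
  rw [hsecond]
  simp only [frobSq, Matrix.sub_apply, hsample, hmean, Finset.mul_sum]
  rw [Finset.sum_comm]
  simp only [← Finset.sum_sub_distrib, Finset.mul_sum]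
  refine Finset.sum_congr rfl fun a _ => ?_
  rw [Finset.sum_comm]
  refine Finset.sum_congr rfl fun b _ => ?_
  exact sum_prod_mul_sq_mean_sub q (fun j => A a j * A b j / q j) hq hr

/-- Proposition 1: with `X_r = X D H` (so `X_r X_rᵀ = X Xᵀ`), sampling `r` columns of
`X_r` i.i.d. with probabilities `pⱼ = ‖X_{r(:,j)}‖₂² / ∑ₖ ‖X_{r(:,k)}‖₂²` (and rescaling
by `1/√(r pⱼ)`) minimizes the expected squared Frobenius error
`E‖X̃ X̃ᵀ − X Xᵀ‖_F²` over all probability vectors, and the minimum value is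
`(1/r) * ((∑ₖ ‖X_{r(:,k)}‖₂²)² − ‖X Xᵀ‖_F²)`. Expectations are over the `r` i.i.d.
column draws: the weight of a draw `ω : Fin r → Fin d` is `∏ t, q (ω t)`. -/
theorem optimal_sampling_probabilities {n d : ℕ} (r : ℕ) (hr : 0 < r)
    (X : Matrix (Fin n) (Fin d) ℝ) (D H : Matrix (Fin d) (Fin d) ℝ)
    (hDdiag : ∀ i j, i ≠ j → D i j = 0)
    (hDsign : ∀ i, D i i = 1 ∨ D i i = -1)
    (hH : H * Hᵀ = 1) :
    let Xr := X * D * H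
    let colSq : Fin d → ℝ := fun jj => ∑ ii, (Xr ii jj) ^ 2
    let p : Fin d → ℝ := fun jj => colSq jj / ∑ k, colSq k
    let err : (Fin d → ℝ) → ℝ := fun q =>
      ∑ ω : Fin r → Fin d, (∏ t, q (ω t)) *
        frobSq ((sampledMatrix r Xr q ω) * (sampledMatrix r Xr q ω)ᵀ - X * Xᵀ)
    (∀ q : Fin d → ℝ, (∀ jj, 0 < q jj) → ∑ jj, q jj = 1 → err p ≤ err q) ∧
      err p = (1 / r) * ((∑ k, colSq k) ^ 2 - frobSq (X * Xᵀ)) := by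
  intro Xr colSq p err
  have hD : D * Dᵀ = 1 := by
    ext i j
    rw [Matrix.mul_apply, Finset.sum_eq_single i (fun k _ hk => by simp [hDdiag i k hk.symm])
      (by simp), Matrix.transpose_apply]
    by_cases hij : i = j
    · subst hij
      rcases hDsign i with h | h <;> simp [h]
    · simp [hDdiag j i (Ne.symm hij), hij]
  have hgram : X * Xᵀ = Xr * Xrᵀ := by
    calc X * Xᵀ = X * (D * (H * Hᵀ) * Dᵀ) * Xᵀ := by rw [hH, Matrix.mul_one, hD, Matrix.mul_one]
      _ = Xr * Xrᵀ := by simp only [Xr, Matrix.transpose_mul, Matrix.mul_assoc]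
  have hcol (j : Fin d) : 0 ≤ colSq j := Finset.sum_nonneg fun _ _ => sq_nonneg _
  have hzero (j : Fin d) (hj : colSq j = 0) (a : Fin n) : Xr a j = 0 :=
    pow_eq_zero_iff two_ne_zero |>.1
      ((Finset.sum_eq_zero_iff_of_nonneg fun _ _ => sq_nonneg _).1 hj a (Finset.mem_univ a))
  have herr (q : Fin d → ℝ) (hq₀ : ∀ j, 0 ≤ q j) (hq : ∑ j, q j = 1)
      (hA : ∀ j, q j = 0 → ∀ a, Xr a j = 0) :
      err q = (1 / r) * (∑ j, colSq j ^ 2 / q j - frobSq (X * Xᵀ)) := by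
    simp only [err, hgram]
    exact sum_prod_mul_frobSq_sampledMatrix hr Xr q hq₀ hq hA
  have hval : err p = (1 / r) * ((∑ k, colSq k) ^ 2 - frobSq (X * Xᵀ)) := by
    by_cases hS : ∑ k, colSq k = 0
    · have hXr : Xr = 0 := by
        ext a j
        exact hzero j ((Finset.sum_eq_zero_iff_of_nonneg fun k _ => hcol k).1 hS j
          (Finset.mem_univ j)) a
      simp [err, p, hS, hgram, hXr, frobSq, hr.ne']
    · rw [herr p (fun j => div_nonneg (hcol j) (Finset.sum_nonneg fun k _ => hcol k))
        (by rw [← Finset.sum_div, div_self hS])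
        (fun j hj => hzero j ((div_eq_zero_iff.1 hj).resolve_right hS))]
      congr 2
      rw [sq (∑ k, colSq k), Finset.sum_mul]
      refine Finset.sum_congr rfl fun j _ => ?_
      by_cases hj : colSq j = 0
      · simp [hj]
      · simp only [p]
        field_simp
  refine ⟨fun q hq₀ hq => ?_, hval⟩
  rw [hval, herr q (fun j => (hq₀ j).le) hq fun j hj => absurd hj (hq₀ j).ne']
  gcongr
  simpa [hq] using Finset.sq_sum_div_le_sum_sq_div Finset.univ colSq fun j _ => hq₀ j
end

section
/- (Johnson–Lindenstrauss) For every $0 < \epsilon < 1$ and every finite set $V$ of $n$ points in $\mathbb{R}^d$, there exists an integer $r = O(\log n / \epsilon^2)$ (concretely, one may take any $r \geq C \log n / \epsilon^2$ for an absolute constant $C$) and a linear map $f : \mathbb{R}^d \to \mathbb{R}^r$ such that for all $x_i, x_j \in V$: $(1-\epsilon)\|x_i - x_j\|_2 \leq \|f(x_i) - f(x_j)\|_2 \leq (1+\epsilon)\|x_i - x_j\|_2$. -/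
open MeasureTheory ProbabilityTheory
open scoped RealInnerProductSpace

lemma gaussianPDFReal_mul_exp_mul_sq (h x : ℝ) :
    gaussianPDFReal 0 1 x * Real.exp (h * x ^ 2) =
      (√(2 * Real.pi))⁻¹ * Real.exp (-(1 / 2 - h) * x ^ 2) := by
  rw [gaussianPDFReal_def]
  simp only [NNReal.coe_one, mul_one, sub_zero]
  rw [mul_assoc, ← Real.exp_add]
  ring_nf

lemma integrable_exp_mul_sq_gaussianReal {h : ℝ} (hh : h < 1 / 2) :
    Integrable (fun x => Real.exp (h * x ^ 2)) (gaussianReal 0 1) := by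
  rw [gaussianReal_of_var_ne_zero 0 one_ne_zero,
    integrable_withDensity_iff_integrable_smul' (measurable_gaussianPDF 0 1)
      (ae_of_all _ fun _ => gaussianPDF_lt_top)]
  simp only [toReal_gaussianPDF, smul_eq_mul, gaussianPDFReal_mul_exp_mul_sq]
  exact (integrable_exp_neg_mul_sq (by linarith)).const_mul _

lemma integral_exp_mul_sq_gaussianReal {h : ℝ} (hh : h < 1 / 2) :
    ∫ x, Real.exp (h * x ^ 2) ∂gaussianReal 0 1 = √((1 - 2 * h)⁻¹) := by
  rw [integral_gaussianReal_eq_integral_smul one_ne_zero]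
  simp only [smul_eq_mul, gaussianPDFReal_mul_exp_mul_sq]
  rw [integral_const_mul, integral_gaussian, ← Real.sqrt_inv, ← Real.sqrt_mul (by positivity)]
  have : 1 / 2 - h ≠ 0 := by linarith
  have : 1 - 2 * h ≠ 0 := by linarith
  congr 1
  field_simp

lemma sqrt_inv_one_sub_two_mul_le_exp {h : ℝ} (hh : |h| ≤ 1 / 4) :
    √((1 - 2 * h)⁻¹) ≤ Real.exp (h + 4 * h ^ 2) := by
  have habs : |2 * h| ≤ 1 / 2 := by
    rw [abs_mul, abs_two]
    linarith
  have hpos : 0 < 1 - 2 * h := by linarith [le_abs_self (2 * h)]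
  have hlog := Real.abs_log_sub_add_sum_range_le (x := 2 * h) (by linarith) 1
  have hfrac : |2 * h| ^ (1 + 1) / (1 - |2 * h|) ≤ 8 * h ^ 2 := by
    rw [div_le_iff₀ (by linarith), one_add_one_eq_two, sq_abs]
    nlinarith [sq_nonneg h]
  have hlower := neg_le_of_abs_le (hlog.trans hfrac)
  simp only [Finset.sum_range_one, zero_add, pow_one, Nat.cast_zero, div_one] at hlower
  rw [Real.sqrt_le_left (Real.exp_pos _).le, ← Real.exp_nat_mul,
    ← Real.exp_log (inv_pos.2 hpos), Real.log_inv, Real.exp_le_exp]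
  push_cast
  linarith

section GaussianProjection

variable {E : Type*} [NormedAddCommGroup E] [InnerProductSpace ℝ E] [FiniteDimensional ℝ E]
  [MeasurableSpace E] [BorelSpace E]

lemma map_inner_stdGaussian {u : E} (hu : ‖u‖ = 1) :
    (stdGaussian E).map (fun x => ⟪x, u⟫) = gaussianReal 0 1 := by
  have hfun : (fun x : E => ⟪x, u⟫) = innerSL ℝ u := by
    ext x
    rw [innerSL_apply_apply, real_inner_comm]
  rw [hfun, IsGaussian.map_eq_gaussianReal, integral_strongDual_stdGaussian,
    variance_dual_stdGaussian, innerSL_apply_norm, hu]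
  simp

lemma integrable_exp_mul_inner_sq_stdGaussian {u : E} (hu : ‖u‖ = 1) {h : ℝ} (hh : h < 1 / 2) :
    Integrable (fun x => Real.exp (h * ⟪x, u⟫ ^ 2)) (stdGaussian E) := by
  have := integrable_exp_mul_sq_gaussianReal hh
  rw [← map_inner_stdGaussian hu] at this
  exact this.comp_measurable (by fun_prop)

lemma integral_exp_mul_inner_sq_stdGaussian_le {u : E} (hu : ‖u‖ = 1) {h : ℝ}
    (hh : |h| ≤ 1 / 4) :
    ∫ x, Real.exp (h * ⟪x, u⟫ ^ 2) ∂stdGaussian E ≤ Real.exp (h + 4 * h ^ 2) := by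
  have hmap := integral_map (μ := stdGaussian E) (φ := fun x => ⟪x, u⟫)
    (f := fun t : ℝ => Real.exp (h * t ^ 2)) (by fun_prop)
    (by fun_prop)
  rw [← hmap, map_inner_stdGaussian hu,
    integral_exp_mul_sq_gaussianReal (by linarith [le_abs_self h])]
  exact sqrt_inv_one_sub_two_mul_le_exp hh

variable {ι : Type*} [Fintype ι]

lemma exp_mul_sum_sub_eq_mul_prod (h c : ℝ) (a : ι → ℝ) :
    Real.exp (h * (∑ i, a i - c)) = Real.exp (-(h * c)) * ∏ i, Real.exp (h * a i) := by
  rw [← Real.exp_sum, ← Real.exp_add, ← Finset.mul_sum]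
  ring_nf

lemma integrable_exp_mul_sum_inner_sq_sub {u : E} (hu : ‖u‖ = 1) {h : ℝ} (hh : h < 1 / 2)
    (c : ℝ) :
    Integrable (fun ω : ι → E => Real.exp (h * (∑ i, ⟪ω i, u⟫ ^ 2 - c)))
      (Measure.pi fun _ => stdGaussian E) := by
  simp only [exp_mul_sum_sub_eq_mul_prod]
  exact (Integrable.fintype_prod (f := fun _ x => Real.exp (h * ⟪x, u⟫ ^ 2)) fun _ : ι =>
    integrable_exp_mul_inner_sq_stdGaussian hu hh).const_mul _

lemma integral_exp_mul_sum_inner_sq_sub_le {u : E} (hu : ‖u‖ = 1) {h : ℝ} (hh : |h| ≤ 1 / 4)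
    (c : ℝ) :
    ∫ ω : ι → E, Real.exp (h * (∑ i, ⟪ω i, u⟫ ^ 2 - c)) ∂(Measure.pi fun _ => stdGaussian E) ≤
      Real.exp (Fintype.card ι * (h + 4 * h ^ 2) - h * c) := by
  simp only [exp_mul_sum_sub_eq_mul_prod]
  rw [integral_const_mul,
    integral_fintype_prod_eq_pow (fun x : E => Real.exp (h * ⟪x, u⟫ ^ 2)),
    sub_eq_neg_add, Real.exp_add, Real.exp_nat_mul]
  gcongr
  exact integral_exp_mul_inner_sq_stdGaussian_le hu hh

/-- A finite set of fewer than `exp (r ε² / 16) / 2` unit vectors admits `r` vectors whose squared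
inner products with each of them sum to `r (1 ± ε)`. -/
lemma exists_abs_sum_inner_sq_sub_card_le (S : Finset E) (hS : ∀ u ∈ S, ‖u‖ = 1) {ε : ℝ}
    (hε : 0 < ε) (hε' : ε < 1)
    (hcard : S.card * (2 * Real.exp (-(Fintype.card ι * ε ^ 2 / 16))) < 1) :
    ∃ ω : ι → E, ∀ u ∈ S,
      |∑ i, ⟪ω i, u⟫ ^ 2 - Fintype.card ι| ≤ ε * Fintype.card ι := by
  set r : ℝ := (Fintype.card ι : ℝ) with hr
  let P : Measure (ι → E) := Measure.pi fun _ => stdGaussian E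
  let X : E → (ι → E) → ℝ := fun u ω => ∑ i, ⟪ω i, u⟫ ^ 2
  let F : E → (ι → E) → ℝ := fun u ω =>
    Real.exp (ε / 8 * (X u ω - r * (1 + ε))) + Real.exp (-(ε / 8) * (X u ω - r * (1 - ε)))
  have hint₁ : ∀ u ∈ S, Integrable (fun ω => Real.exp (ε / 8 * (X u ω - r * (1 + ε)))) P :=
    fun u hu => integrable_exp_mul_sum_inner_sq_sub (hS u hu) (by linarith) _
  have hint₂ : ∀ u ∈ S, Integrable (fun ω => Real.exp (-(ε / 8) * (X u ω - r * (1 - ε)))) P :=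
    fun u hu => integrable_exp_mul_sum_inner_sq_sub (hS u hu) (by linarith) _
  have hint : ∀ u ∈ S, Integrable (F u) P := fun u hu => (hint₁ u hu).add (hint₂ u hu)
  have hle : ∀ u ∈ S, ∫ ω, F u ω ∂P ≤ 2 * Real.exp (-(r * ε ^ 2 / 16)) := by
    intro u hu
    have habs : |ε / 8| ≤ 1 / 4 := by
      rw [abs_of_pos (by positivity)]
      linarith
    have h₁ := integral_exp_mul_sum_inner_sq_sub_le (ι := ι) (hS u hu) habs (r * (1 + ε))
    have h₂ := integral_exp_mul_sum_inner_sq_sub_le (ι := ι) (hS u hu)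
      ((abs_neg (ε / 8)).trans_le habs) (r * (1 - ε))
    rw [← hr] at h₁ h₂
    rw [integral_add (hint₁ u hu) (hint₂ u hu), two_mul]
    refine add_le_add (h₁.trans_eq ?_) (h₂.trans_eq ?_) <;> ring_nf
  obtain ⟨ω, hω⟩ := exists_le_integral (integrable_finsetSum S hint)
  rw [integral_finsetSum S hint] at hω
  have hlt : ∑ u ∈ S, F u ω < 1 := by
    refine hω.trans_lt (lt_of_le_of_lt ?_ hcard)
    simpa using Finset.sum_le_card_nsmul S _ _ hle
  refine ⟨ω, fun u hu => ?_⟩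
  have hF : F u ω < 1 :=
    (Finset.single_le_sum (f := fun u => F u ω) (fun _ _ => by positivity) hu).trans_lt hlt
  have h₁ : ε / 8 * (X u ω - r * (1 + ε)) < 0 :=
    Real.exp_lt_one_iff.1 ((le_add_of_nonneg_right (Real.exp_pos _).le).trans_lt hF)
  have h₂ : -(ε / 8) * (X u ω - r * (1 - ε)) < 0 :=
    Real.exp_lt_one_iff.1 ((le_add_of_nonneg_left (Real.exp_pos _).le).trans_lt hF)
  rw [abs_le]
  change -(ε * r) ≤ X u ω - r ∧ X u ω - r ≤ ε * r
  constructor <;> nlinarith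

end GaussianProjection

/-- The linear map with coordinates `x ↦ c * ⟪ω i, x⟫`. -/
noncomputable def innerMap {E ι : Type*} [NormedAddCommGroup E] [InnerProductSpace ℝ E]
    (c : ℝ) (ω : ι → E) : E →ₗ[ℝ] EuclideanSpace ℝ ι :=
  c • ((WithLp.linearEquiv 2 ℝ (ι → ℝ)).symm.toLinearMap ∘ₗ
    LinearMap.pi fun i => (innerSL ℝ (ω i)).toLinearMap)

lemma norm_innerMap_sq {E ι : Type*} [NormedAddCommGroup E] [InnerProductSpace ℝ E] [Fintype ι]
    (c : ℝ) (ω : ι → E) (x : E) :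
    ‖innerMap c ω x‖ ^ 2 = c ^ 2 * ∑ i, ⟪ω i, x⟫ ^ 2 := by
  rw [EuclideanSpace.real_norm_sq_eq, Finset.mul_sum]
  simp [innerMap, mul_pow]

/-- Johnson–Lindenstrauss: there is an absolute constant `C > 0` such that for every
`0 < ε < 1` and every finite set `V` of `n` points in `ℝ^d`, any integer
`r ≥ C log n / ε²` admits a linear map `f : ℝ^d → ℝ^r` preserving all pairwise
Euclidean distances within `V` up to a factor `1 ± ε`. -/
theorem johnson_lindenstrauss :
    ∃ C : ℝ, 0 < C ∧
      ∀ (ε : ℝ), 0 < ε → ε < 1 →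
        ∀ (d n : ℕ) (V : Finset (EuclideanSpace ℝ (Fin d))), V.card = n →
          ∀ r : ℕ, C * Real.log n / ε ^ 2 ≤ (r : ℝ) →
            ∃ f : EuclideanSpace ℝ (Fin d) →ₗ[ℝ] EuclideanSpace ℝ (Fin r),
              ∀ x ∈ V, ∀ y ∈ V,
                (1 - ε) * ‖x - y‖ ≤ ‖f x - f y‖ ∧
                  ‖f x - f y‖ ≤ (1 + ε) * ‖x - y‖ := by
  classical
  refine ⟨64, by norm_num, fun ε hε hε' d n V hV r hr => ?_⟩
  rcases Nat.lt_or_ge n 2 with hn | hn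
  · refine ⟨0, fun x hx y hy => ?_⟩
    obtain rfl := Finset.card_le_one.1 (by omega) x hx y hy
    simp
  have hn' : (2 : ℝ) ≤ n := by exact_mod_cast hn
  have hlog : 0 < Real.log n := Real.log_pos (by linarith)
  have hr₀ : (0 : ℝ) < r := lt_of_lt_of_le (by positivity) hr
  rw [div_le_iff₀ (by positivity)] at hr
  let S := V.offDiag.image fun p => ‖p.1 - p.2‖⁻¹ • (p.1 - p.2)
  have hS : ∀ u ∈ S, ‖u‖ = 1 := by
    intro u hu
    obtain ⟨p, hp, rfl⟩ := Finset.mem_image.1 hu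
    exact norm_smul_inv_norm (𝕜 := ℝ) (sub_ne_zero.2 (Finset.mem_offDiag.1 hp).2.2)
  have hScard : (S.card : ℝ) ≤ (n : ℝ) ^ 2 := by
    have : S.card ≤ n ^ 2 := by
      refine Finset.card_image_le.trans ?_
      rw [Finset.offDiag_card, hV, sq]
      exact Nat.sub_le _ _
    exact_mod_cast this
  have hexp : Real.exp (-(Fintype.card (Fin r) * ε ^ 2 / 16)) ≤ ((n : ℝ) ^ 4)⁻¹ := by
    rw [← Real.exp_log (show (0 : ℝ) < ((n : ℝ) ^ 4)⁻¹ by positivity), Real.exp_le_exp,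
      Real.log_inv, Real.log_pow, Fintype.card_fin]
    push_cast
    linarith
  have hcard : S.card * (2 * Real.exp (-(Fintype.card (Fin r) * ε ^ 2 / 16))) < 1 := by
    calc S.card * (2 * Real.exp (-(Fintype.card (Fin r) * ε ^ 2 / 16)))
        ≤ (n : ℝ) ^ 2 * (2 * ((n : ℝ) ^ 4)⁻¹) := by gcongr
      _ = 2 / (n : ℝ) ^ 2 := by field_simp
      _ < 1 := by
        rw [div_lt_one (by positivity)]
        nlinarith
  obtain ⟨ω, hω⟩ := exists_abs_sum_inner_sq_sub_card_le S hS hε hε' hcard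
  rw [Fintype.card_fin] at hω
  let f := innerMap (√r)⁻¹ ω
  refine ⟨f, fun x hx y hy => ?_⟩
  rcases eq_or_ne x y with rfl | hxy
  · simp
  have hnorm : 0 < ‖x - y‖ := norm_pos_iff.2 (sub_ne_zero.2 hxy)
  set u := ‖x - y‖⁻¹ • (x - y) with hu
  have huS : u ∈ S := Finset.mem_image.2 ⟨(x, y), Finset.mem_offDiag.2 ⟨hx, hy, hxy⟩, rfl⟩
  have hfu : ‖f u‖ ^ 2 = (r : ℝ)⁻¹ * ∑ i, ⟪ω i, u⟫ ^ 2 := by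
    rw [norm_innerMap_sq, inv_pow, Real.sq_sqrt hr₀.le]
  have hfxy : ‖f x - f y‖ = ‖f u‖ * ‖x - y‖ := by
    rw [← map_sub, hu, map_smul, norm_smul, norm_inv, norm_norm]
    field_simp
  obtain ⟨hl, hg⟩ := abs_le.1 (hω u huS)
  have hlow : 1 - ε ≤ ‖f u‖ ^ 2 := by
    rw [hfu, ← div_eq_inv_mul, le_div_iff₀ hr₀]
    linarith
  have hupp : ‖f u‖ ^ 2 ≤ 1 + ε := by
    rw [hfu, ← div_eq_inv_mul, div_le_iff₀ hr₀]
    linarith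
  rw [hfxy]
  constructor
  · gcongr
    refine (sq_le_sq₀ (by linarith) (norm_nonneg _)).1 ?_
    nlinarith
  · gcongr
    refine (sq_le_sq₀ (norm_nonneg _) (by linarith)).1 ?_
    nlinarith
end
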